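/- For ε ∈ (0,1), let φ_ε : (0,1) → ℝ be the hat function defined by φ_ε(x) = x/ε for x ∈ (0,ε) and φ_ε(x) = (1−x)/(1−ε) for x ∈ (ε,1). Then ∫₀¹ φ_ε(x)² dx = 1/3 for every ε ∈ (0,1) (so ‖φ_ε‖_{L²(0,1)} = √3/3 irrespective of ε), while the L²-projection coefficient α_ε, defined by α_ε·(1/3) = ε^{−1}∫₀^ε x^{−1/4} dx − (1−ε)^{−1}∫_ε^1 x^{−1/4} dx, tends to +∞ as ε → 0⁺. In particular, the L²-projection α_ε φ_ε of the rough functional v ↦ ∫₀¹ x^{−1/4} v′(x) dx onto the span of φ_ε diverges in L²(0,1) as ε → 0⁺. -/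

import Mathlib

open MeasureTheory Filter

/-- The hat function `φ_ε` on `(0,1)`: `x/ε` on `(0,ε]` and `(1−x)/(1−ε)` beyond. -/
noncomputable def hatFun (ε x : ℝ) : ℝ :=
  if x ≤ ε then x / ε else (1 - x) / (1 - ε)

/-- The `L²`-projection coefficient `α_ε`, defined by
`α_ε·(1/3) = ε⁻¹∫₀^ε x^{−1/4} dx − (1−ε)⁻¹∫_ε^1 x^{−1/4} dx`. -/
noncomputable def projCoef (ε : ℝ) : ℝ :=
  3 * (ε⁻¹ * (∫ x in (0:ℝ)..ε, x ^ (-(1/4 : ℝ))) -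
       (1 - ε)⁻¹ * (∫ x in ε..(1:ℝ), x ^ (-(1/4 : ℝ))))

theorem hatFun_of_le {ε x : ℝ} (h : x ≤ ε) : hatFun ε x = x / ε :=
  if_pos h

theorem hatFun_of_ge {ε x : ℝ} (h0 : ε ≠ 0) (h1 : ε ≠ 1) (h : ε ≤ x) :
    hatFun ε x = (1 - x) / (1 - ε) := by
  rcases h.eq_or_lt with rfl | h
  · rw [hatFun_of_le le_rfl, div_self h0, div_self (sub_ne_zero.2 h1.symm)]
  · exact if_neg h.not_ge

theorem integral_hatFun_sq {ε : ℝ} (h0 : 0 < ε) (h1 : ε < 1) :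
    ∫ x in (0:ℝ)..1, (hatFun ε x) ^ 2 = 1 / 3 := by
  have hl : Set.EqOn (fun x => (x / ε) ^ 2) (fun x => (hatFun ε x) ^ 2) (Set.uIcc 0 ε) := by
    intro x hx
    rw [Set.uIcc_of_le h0.le] at hx
    simp only [hatFun_of_le hx.2]
  have hr : Set.EqOn (fun x => ((1 - x) / (1 - ε)) ^ 2) (fun x => (hatFun ε x) ^ 2)
      (Set.uIcc ε 1) := by
    intro x hx
    rw [Set.uIcc_of_le h1.le] at hx
    simp only [hatFun_of_ge h0.ne' h1.ne hx.1]
  have il : IntervalIntegrable (fun x => (hatFun ε x) ^ 2) volume 0 ε := by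
    refine IntervalIntegrable.congr (fun x hx => hl (Set.uIoc_subset_uIcc hx)) ?_
    exact Continuous.intervalIntegrable (by fun_prop) _ _
  have ir : IntervalIntegrable (fun x => (hatFun ε x) ^ 2) volume ε 1 := by
    refine IntervalIntegrable.congr (fun x hx => hr (Set.uIoc_subset_uIcc hx)) ?_
    exact Continuous.intervalIntegrable (by fun_prop) _ _
  have h2 : 1 - ε ≠ 0 := (sub_pos.2 h1).ne'
  rw [← intervalIntegral.integral_add_adjacent_intervals il ir,
    ← intervalIntegral.integral_congr hl, ← intervalIntegral.integral_congr hr]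
  simp only [div_pow, intervalIntegral.integral_div]
  rw [intervalIntegral.integral_comp_sub_left (fun x => x ^ 2), integral_pow, integral_pow]
  field_simp
  ring

theorem le_projCoef {ε : ℝ} (h0 : 0 < ε) (h1 : ε < 1) :
    4 * ε ^ (-(1 / 4) : ℝ) - 4 ≤ projCoef ε := by
  have hpow : ε ^ (3 / 4 : ℝ) = ε * ε ^ (-(1 / 4) : ℝ) := by
    rw [← Real.rpow_one_add' h0.le (by norm_num)]
    norm_num
  have hge : ε ≤ ε ^ (3 / 4 : ℝ) := by
    simpa using Real.rpow_le_rpow_of_exponent_ge h0 h1.le (by norm_num : (3 / 4 : ℝ) ≤ 1)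
  have hq : (1 - ε)⁻¹ * (1 - ε ^ (3 / 4 : ℝ)) ≤ 1 := by
    rw [inv_mul_le_one₀ (sub_pos.2 h1)]
    linarith
  have hl : ε⁻¹ * ε ^ (3 / 4 : ℝ) = ε ^ (-(1 / 4) : ℝ) := by
    rw [hpow, inv_mul_cancel_left₀ h0.ne']
  have e : (-(1 / 4) + 1 : ℝ) = 3 / 4 := by norm_num
  rw [projCoef, integral_rpow (Or.inl (by norm_num)), integral_rpow (Or.inl (by norm_num)), e,
    Real.one_rpow, Real.zero_rpow (by norm_num), ← hl]
  linarith

theorem tendsto_projCoef : Tendsto projCoef (nhdsWithin 0 (Set.Ioi 0)) atTop := by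
  have h : Tendsto (fun ε : ℝ => 4 * ε ^ (-(1 / 4) : ℝ) - 4) (nhdsWithin 0 (Set.Ioi 0)) atTop :=
    tendsto_atTop_add_const_right _ _
      ((tendsto_rpow_neg_nhdsGT_zero (by norm_num)).const_mul_atTop (by norm_num))
  refine tendsto_atTop_mono' _ ?_ h
  filter_upwards [Ioo_mem_nhdsGT (zero_lt_one' ℝ)] with ε hε using le_projCoef hε.1 hε.2

/-- Instability of the `L²`-projection of the rough functional
`v ↦ ∫₀¹ x^{−1/4} v'(x) dx`: the squared `L²` norm of `φ_ε` is `1/3` for every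
`ε ∈ (0,1)`, the projection coefficient `α_ε` blows up as `ε → 0⁺`, and hence
the `L²` norm of the projection `α_ε φ_ε` diverges as `ε → 0⁺`. -/
theorem L2_projection_instability :
    (∀ ε ∈ Set.Ioo (0:ℝ) 1, (∫ x in (0:ℝ)..1, (hatFun ε x) ^ 2) = 1 / 3) ∧
    Tendsto projCoef (nhdsWithin 0 (Set.Ioi 0)) atTop ∧
    Tendsto (fun ε : ℝ => Real.sqrt (∫ x in (0:ℝ)..1, (projCoef ε * hatFun ε x) ^ 2))
      (nhdsWithin 0 (Set.Ioi 0)) atTop := by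
  refine ⟨fun ε hε => integral_hatFun_sq hε.1 hε.2, tendsto_projCoef, ?_⟩
  have h := (tendsto_abs_atTop_atTop.comp tendsto_projCoef).atTop_mul_const
    (Real.sqrt_pos.2 (by norm_num : (0 : ℝ) < 1 / 3))
  refine h.congr' ?_
  filter_upwards [Ioo_mem_nhdsGT (zero_lt_one' ℝ)] with ε hε
  simp only [mul_pow, intervalIntegral.integral_const_mul, Function.comp_apply]
  rw [integral_hatFun_sq hε.1 hε.2, Real.sqrt_mul (sq_nonneg _), Real.sqrt_sq_eq_abs]
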